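/- Suppose M is CM over ℚ, so that the set C of elements of G induced by complex conjugation consists of a single element c and t = t_c. Assume both Schanuel's Conjecture (real logarithmic form) and the p-adic Schanuel Conjecture. Then rk((log_p(σ_i(g_j(ε))))_{σ_i ∈ S_p, g_j ∈ G}) = r − (t−1)^+. -/

import Mathlib

open scoped NumberField
open Filter

/-- The `p`-adic logarithm on a complete normed field `Cp` (a stand-in for `ℂ_p`), defined by
the power series `log_p x = ∑_{k ≥ 1} (-1)^(k+1) (x-1)^k / k` (convergent for `‖x - 1‖ < 1`). -/
noncomputable def plog (Cp : Type*) [NormedField Cp] (x : Cp) : Cp :=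
  ∑' k : ℕ, (-1) ^ (k + 1 + 1) * (x - 1) ^ (k + 1) / ((k : Cp) + 1)

/-- The `p`-adic Schanuel conjecture. -/
def PadicSchanuel (Cp : Type*) [NormedField Cp] [CharZero Cp] : Prop :=
  ∀ (m : ℕ) (α : Fin m → Cp),
    (∀ i, IsAlgebraic ℚ (α i)) → (∀ i, ‖α i - 1‖ < 1) →
    LinearIndependent ℚ (fun i => plog Cp (α i)) →
    AlgebraicIndependent ℚ (fun i => plog Cp (α i))

/-- Schanuel's conjecture, real logarithmic form. -/
def RealSchanuel : Prop :=
  ∀ (m : ℕ) (β : Fin m → ℝ), (∀ i, 0 < β i) → (∀ i, IsAlgebraic ℚ (β i)) →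
    LinearIndependent ℚ (fun i => Real.log (β i)) →
    AlgebraicIndependent ℚ (fun i => Real.log (β i))

/-- `M` is CM over `ℚ`: a totally imaginary quadratic extension of a totally real field. -/
def IsCMExt (M : Type*) [Field M] [NumberField M] : Prop :=
  (∀ τ : M →+* ℂ, ∃ x : M, (τ x).im ≠ 0) ∧
  ∃ K : Subfield M, (∀ τ : K →+* ℂ, ∀ x : K, (τ x).im = 0) ∧ Module.finrank K M = 2

/-- The matrix `(log_p (σ (g ε)))` with rows indexed by `S_p ⊆ E_p` and columns by `G`. -/
noncomputable def padicLogMatrix (Cp : Type*) [NormedField Cp] (M : Type*) [Field M]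
    [NumberField M] (S : Set (M →+* Cp)) (ε : M) : Matrix S (M ≃ₐ[ℚ] M) Cp :=
  fun σ g => plog Cp (σ.1 (g ε))

/-- `ε ∈ O_M^*` is a weak Minkowski unit. -/
def IsWeakMinkowskiUnit (M : Type*) [Field M] [NumberField M] (ε : (𝓞 M)ˣ) : Prop :=
  ∃ u : (M ≃ₐ[ℚ] M) → (𝓞 M)ˣ,
    (∀ g, algebraMap (𝓞 M) M (u g) = g (algebraMap (𝓞 M) M ε)) ∧
    (Subgroup.closure (Set.range u)).FiniteIndex

/-- `c ∈ G` is induced by complex conjugation: `τ ∘ c = conj ∘ τ` for some `τ ∈ E`. -/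
def InducedByConj (M : Type*) [Field M] [NumberField M] (g : M ≃ₐ[ℚ] M) : Prop :=
  ∃ τ : M →+* ℂ, ∀ x : M, τ (g x) = (starRingEnd ℂ) (τ x)

/-- `J_σ = {g ∈ G : σ ∘ g ∈ E_p ∖ S_p}`. -/
def Jset (Cp : Type*) [Field Cp] (M : Type*) [Field M] [NumberField M] (Sp : Set (M →+* Cp))
    (σ : M →+* Cp) : Set (M ≃ₐ[ℚ] M) :=
  {g | σ.comp (g : M →+* M) ∉ Sp}

/-- `t_c`: the number of right cosets `{g, cg}` of `{id, c}` contained in `J`. -/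
noncomputable def tcos {M : Type*} [Field M] [NumberField M] (c : M ≃ₐ[ℚ] M) (J : Set (M ≃ₐ[ℚ] M)) : ℕ :=
  Set.ncard {s : Set (M ≃ₐ[ℚ] M) | (∃ g, s = {g, c * g}) ∧ s ⊆ J}


section PadicLogarithm

variable {p : ℕ} [Fact p.Prime] {Cp : Type*} [NormedField Cp] [Algebra ℚ_[p] Cp]

theorem norm_natCast_eq_padic_norm (hpadic : ∀ x : ℚ_[p], ‖algebraMap ℚ_[p] Cp x‖ = ‖x‖) (k : ℕ) :
    ‖(k : Cp)‖ = ‖(k : ℚ_[p])‖ := by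
  simpa using hpadic k

theorem norm_natCast_le_one_of_padic (hpadic : ∀ x : ℚ_[p], ‖algebraMap ℚ_[p] Cp x‖ = ‖x‖)
    (k : ℕ) : ‖(k : Cp)‖ ≤ 1 := by
  rw [norm_natCast_eq_padic_norm hpadic]
  exact_mod_cast Padic.norm_int_le_one (p := p) k

theorem norm_prime_lt_one_of_padic (hpadic : ∀ x : ℚ_[p], ‖algebraMap ℚ_[p] Cp x‖ = ‖x‖) :
    ‖(p : Cp)‖ < 1 := by
  rw [norm_natCast_eq_padic_norm hpadic]
  exact Padic.norm_p_lt_one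

theorem inv_norm_natCast_le_of_padic (hpadic : ∀ x : ℚ_[p], ‖algebraMap ℚ_[p] Cp x‖ = ‖x‖)
    {k : ℕ} (hk : k ≠ 0) : ‖(k : Cp)‖⁻¹ ≤ k := by
  rw [norm_natCast_eq_padic_norm hpadic,
    Padic.norm_eq_zpow_neg_valuation (Nat.cast_ne_zero.mpr hk), Padic.valuation_natCast,
    zpow_neg, inv_inv, zpow_natCast]
  exact_mod_cast Nat.le_of_dvd (Nat.pos_of_ne_zero hk) pow_padicValNat_dvd

theorem isUltrametricDist_of_padic (hpadic : ∀ x : ℚ_[p], ‖algebraMap ℚ_[p] Cp x‖ = ‖x‖) :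
    IsUltrametricDist Cp :=
  IsUltrametricDist.isUltrametricDist_of_forall_norm_natCast_le_one
    (norm_natCast_le_one_of_padic hpadic)

theorem norm_mul_sub_one_lt_one (hpadic : ∀ x : ℚ_[p], ‖algebraMap ℚ_[p] Cp x‖ = ‖x‖)
    {x y : Cp} (hx : ‖x - 1‖ < 1) (hy : ‖y - 1‖ < 1) : ‖x * y - 1‖ < 1 := by
  have := isUltrametricDist_of_padic hpadic
  have h : x * y - 1 = (x - 1) * (y - 1) + ((x - 1) + (y - 1)) := by ring
  rw [h]
  refine (IsUltrametricDist.norm_add_le_max _ _).trans_lt (max_lt ?_ ?_)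
  · rw [norm_mul]
    exact mul_lt_one_of_nonneg_of_lt_one_left (norm_nonneg _) hx hy.le
  · exact (IsUltrametricDist.norm_add_le_max _ _).trans_lt (max_lt hx hy)

variable [CharZero Cp]

theorem tendsto_choose_prime_pow (hpadic : ∀ x : ℚ_[p], ‖algebraMap ℚ_[p] Cp x‖ = ‖x‖) (j : ℕ) :
    Tendsto (fun n : ℕ => (((p ^ n).choose (j + 1) : ℕ) : Cp)) atTop (nhds 0) := by
  have hpow : Tendsto (fun n : ℕ => ‖(p : Cp)‖ ^ n * ((j + 1 : ℕ) : ℝ)) atTop (nhds 0) := by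
    simpa using (tendsto_pow_atTop_nhds_zero_of_lt_one (norm_nonneg _)
      (norm_prime_lt_one_of_padic hpadic)).mul_const ((j + 1 : ℕ) : ℝ)
  refine squeeze_zero_norm (fun n => ?_) hpow
  have hj : ((j + 1 : ℕ) : Cp) ≠ 0 := Nat.cast_ne_zero.mpr (Nat.succ_ne_zero j)
  have hp : 0 < p ^ n := pow_pos (Fact.out : p.Prime).pos n
  have key : ((p ^ n).choose (j + 1) : Cp) =
      (p : Cp) ^ n * ((p ^ n - 1).choose j : ℕ) * ((j + 1 : ℕ) : Cp)⁻¹ := by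
    rw [eq_mul_inv_iff_mul_eq₀ hj]
    have h := Nat.add_one_mul_choose_eq (p ^ n - 1) j
    rw [Nat.sub_add_cancel hp] at h
    exact_mod_cast h.symm
  rw [key, norm_mul, norm_mul, norm_pow, norm_inv]
  refine mul_le_mul ?_ (inv_norm_natCast_le_of_padic hpadic (Nat.succ_ne_zero j))
    (by positivity) (by positivity)
  exact mul_le_of_le_one_right (by positivity) (norm_natCast_le_one_of_padic hpadic _)

theorem tendsto_choose_prime_pow_sub_one (hpadic : ∀ x : ℚ_[p], ‖algebraMap ℚ_[p] Cp x‖ = ‖x‖)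
    (j : ℕ) :
    Tendsto (fun n : ℕ => (((p ^ n - 1).choose j : ℕ) : Cp)) atTop (nhds ((-1) ^ j)) := by
  induction j with
  | zero => simp
  | succ j ih =>
    have h := (tendsto_choose_prime_pow hpadic j).sub ih
    rw [zero_sub, ← neg_one_mul, ← pow_succ'] at h
    refine h.congr fun n => ?_
    have hp : 0 < p ^ n := pow_pos (Fact.out : p.Prime).pos n
    have h2 := Nat.choose_succ_succ (p ^ n - 1) j
    rw [Nat.succ_eq_add_one, Nat.sub_add_cancel hp] at h2
    rw [h2]
    push_cast
    ring

omit [Algebra ℚ_[p] Cp] in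
theorem sub_one_pow_div_eq_tsum (x : Cp) (n : ℕ) :
    (x ^ p ^ n - 1) / (p : Cp) ^ n =
      ∑' k : ℕ, (((p ^ n - 1).choose k : ℕ) : Cp) * ((x - 1) ^ (k + 1) / ((k : Cp) + 1)) := by
  have hp : 0 < p ^ n := pow_pos (Fact.out : p.Prime).pos n
  have hp0 : (p : Cp) ^ n ≠ 0 := pow_ne_zero _ (Nat.cast_ne_zero.mpr (Fact.out : p.Prime).ne_zero)
  rw [tsum_eq_sum (s := Finset.range (p ^ n)), div_eq_iff hp0, Finset.sum_mul]
  · nth_rewrite 1 [← sub_add_cancel x 1]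
    rw [add_pow, Finset.sum_range_succ']
    simp only [one_pow, mul_one, pow_zero, Nat.choose_zero_right, Nat.cast_one, add_sub_cancel_right]
    refine Finset.sum_congr rfl fun k _ => ?_
    have hk : ((k : Cp) + 1) ≠ 0 := Nat.cast_add_one_ne_zero k
    have h := Nat.add_one_mul_choose_eq (p ^ n - 1) k
    rw [Nat.sub_add_cancel hp] at h
    have h' : (p : Cp) ^ n * ((p ^ n - 1).choose k : ℕ) =
      ((p ^ n).choose (k + 1) : ℕ) * ((k : Cp) + 1) := by exact_mod_cast h
    field_simp
    linear_combination (-(x - 1) ^ (k + 1)) * h'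
  · intro k hk
    rw [Finset.mem_range, not_lt] at hk
    rw [Nat.choose_eq_zero_of_lt (by omega)]
    simp

omit [CharZero Cp] in
theorem norm_pow_div_le (hpadic : ∀ x : ℚ_[p], ‖algebraMap ℚ_[p] Cp x‖ = ‖x‖) (z : Cp) (k : ℕ) :
    ‖z ^ (k + 1) / ((k : Cp) + 1)‖ ≤ ((k + 1 : ℕ) : ℝ) * ‖z‖ ^ (k + 1) := by
  rw [norm_div, norm_pow, div_eq_inv_mul]
  refine mul_le_mul_of_nonneg_right ?_ (by positivity)
  have h := inv_norm_natCast_le_of_padic hpadic (Nat.succ_ne_zero k)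
  simpa using h

theorem summable_succ_mul_pow_succ {r : ℝ} (hr0 : 0 ≤ r) (hr : r < 1) :
    Summable fun k : ℕ => ((k + 1 : ℕ) : ℝ) * r ^ (k + 1) := by
  have h := summable_pow_mul_geometric_of_norm_lt_one 1 (r := r)
    (by rwa [Real.norm_of_nonneg hr0])
  simp only [pow_one] at h
  exact (summable_nat_add_iff 1).mpr h

theorem tendsto_plog [CompleteSpace Cp] (hpadic : ∀ x : ℚ_[p], ‖algebraMap ℚ_[p] Cp x‖ = ‖x‖)
    {x : Cp} (hx : ‖x - 1‖ < 1) :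
    Tendsto (fun n : ℕ => (x ^ p ^ n - 1) / (p : Cp) ^ n) atTop (nhds (plog Cp x)) := by
  have h := tendsto_tsum_of_dominated_convergence (𝓕 := atTop)
    (f := fun (n k : ℕ) =>
      (((p ^ n - 1).choose k : ℕ) : Cp) * ((x - 1) ^ (k + 1) / ((k : Cp) + 1)))
    (g := fun k : ℕ => (-1) ^ k * ((x - 1) ^ (k + 1) / ((k : Cp) + 1)))
    (summable_succ_mul_pow_succ (norm_nonneg _) hx)
    (fun k => (tendsto_choose_prime_pow_sub_one hpadic k).mul_const _)
    (Eventually.of_forall fun n k => by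
      rw [norm_mul]
      exact (mul_le_of_le_one_left (norm_nonneg _) (norm_natCast_le_one_of_padic hpadic _)).trans
        (norm_pow_div_le hpadic _ k))
  have hlim : plog Cp x = ∑' k : ℕ, (-1) ^ k * ((x - 1) ^ (k + 1) / ((k : Cp) + 1)) := by
    refine tsum_congr fun k => ?_
    ring
  rw [hlim]
  exact h.congr fun n => (sub_one_pow_div_eq_tsum x n).symm

theorem tendsto_pow_prime_pow_sub_one [CompleteSpace Cp]
    (hpadic : ∀ x : ℚ_[p], ‖algebraMap ℚ_[p] Cp x‖ = ‖x‖) {x : Cp} (hx : ‖x - 1‖ < 1) :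
    Tendsto (fun n : ℕ => x ^ p ^ n - 1) atTop (nhds 0) := by
  have hp0 (n : ℕ) : (p : Cp) ^ n ≠ 0 :=
    pow_ne_zero _ (Nat.cast_ne_zero.mpr (Fact.out : p.Prime).ne_zero)
  have h := (tendsto_plog hpadic hx).mul
    (tendsto_pow_atTop_nhds_zero_of_norm_lt_one (norm_prime_lt_one_of_padic hpadic))
  rw [mul_zero] at h
  exact h.congr fun n => div_mul_cancel₀ _ (hp0 n)

theorem plog_mul [CompleteSpace Cp] (hpadic : ∀ x : ℚ_[p], ‖algebraMap ℚ_[p] Cp x‖ = ‖x‖)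
    {x y : Cp} (hx : ‖x - 1‖ < 1) (hy : ‖y - 1‖ < 1) :
    plog Cp (x * y) = plog Cp x + plog Cp y := by
  have h1 := tendsto_plog hpadic (norm_mul_sub_one_lt_one hpadic hx hy)
  have h2 := ((tendsto_plog hpadic hx).mul (tendsto_pow_prime_pow_sub_one hpadic hy)).add
    ((tendsto_plog hpadic hx).add (tendsto_plog hpadic hy))
  rw [mul_zero, zero_add] at h2
  refine tendsto_nhds_unique h1 (h2.congr fun n => ?_)
  rw [mul_pow]
  ring

omit [CharZero Cp] in
theorem plog_one : plog Cp 1 = 0 := by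
  simp [plog]

omit [CharZero Cp] in
theorem norm_pow_sub_one_lt_one (hpadic : ∀ x : ℚ_[p], ‖algebraMap ℚ_[p] Cp x‖ = ‖x‖)
    {x : Cp} (hx : ‖x - 1‖ < 1) (n : ℕ) : ‖x ^ n - 1‖ < 1 := by
  induction n with
  | zero => simp
  | succ n ih => exact pow_succ x n ▸ norm_mul_sub_one_lt_one hpadic ih hx

theorem plog_pow [CompleteSpace Cp] (hpadic : ∀ x : ℚ_[p], ‖algebraMap ℚ_[p] Cp x‖ = ‖x‖)
    {x : Cp} (hx : ‖x - 1‖ < 1) (n : ℕ) : plog Cp (x ^ n) = n * plog Cp x := by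
  induction n with
  | zero => simp [plog_one]
  | succ n ih =>
    rw [pow_succ, plog_mul hpadic (norm_pow_sub_one_lt_one hpadic hx n) hx, ih]
    push_cast
    ring

theorem eq_one_of_plog_eq_zero_of_norm_le [CompleteSpace Cp]
    (hpadic : ∀ x : ℚ_[p], ‖algebraMap ℚ_[p] Cp x‖ = ‖x‖)
    {x : Cp} (hx : ‖x - 1‖ ≤ 1 / 8) (h0 : plog Cp x = 0) : x = 1 := by
  by_contra hne
  set z := x - 1 with hz
  have hzpos : 0 < ‖z‖ := norm_pos_iff.mpr (sub_ne_zero.mpr hne)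
  have hz1 : ‖z‖ < 1 := hx.trans_lt (by norm_num)
  have hs : Summable fun k : ℕ => (-1 : Cp) ^ (k + 1 + 1) * z ^ (k + 1) / ((k : Cp) + 1) := by
    refine Summable.of_norm_bounded (summable_succ_mul_pow_succ (norm_nonneg z) hz1) fun k => ?_
    rw [mul_div_assoc, norm_mul]
    simpa using norm_pow_div_le hpadic z k
  have hsplit := hs.tsum_eq_zero_add
  rw [show (∑' k : ℕ, (-1 : Cp) ^ (k + 1 + 1) * z ^ (k + 1) / ((k : Cp) + 1)) = 0 from h0] at hsplit
  have hgeo : HasSum (fun k : ℕ => ‖z‖ * (1 / 2) ^ (k + 1) / 2) (‖z‖ / 2) := by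
    have h := (hasSum_geometric_two.mul_left (‖z‖ / 4))
    have hval : ‖z‖ / 4 * 2 = ‖z‖ / 2 := by ring
    rw [hval] at h
    exact h.congr_fun fun k => by ring
  have htail : ‖∑' k : ℕ, (-1 : Cp) ^ (k + 1 + 1 + 1) * z ^ (k + 1 + 1) / (((k + 1 : ℕ) : Cp) + 1)‖
      ≤ ‖z‖ / 2 := by
    refine tsum_of_norm_bounded hgeo fun k => ?_
    rw [mul_div_assoc, norm_mul]
    simp only [norm_pow, norm_neg, norm_one, one_pow, one_mul]
    refine (norm_pow_div_le hpadic z (k + 1)).trans ?_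
    have hk : ((k + 1 + 1 : ℕ) : ℝ) ≤ 2 * 2 ^ (k + 1) / 2 := by
      have : k + 1 + 1 ≤ 2 ^ (k + 1) := Nat.lt_two_pow_self
      have : ((k + 1 + 1 : ℕ) : ℝ) ≤ 2 ^ (k + 1) := by exact_mod_cast this
      linarith
    have hpow : ‖z‖ ^ (k + 1) ≤ (1 / 8) ^ (k + 1) := pow_le_pow_left₀ (norm_nonneg z) hx _
    have h4 : (2 : ℝ) ^ (k + 1) * (1 / 8) ^ (k + 1) = (1 / 2) ^ (k + 1) * (1 / 2) ^ (k + 1) := by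
      rw [← mul_pow, ← mul_pow]; norm_num
    have h5 : ((1 : ℝ) / 2) ^ (k + 1) ≤ 1 / 2 := by
      rw [pow_succ]
      exact mul_le_of_le_one_left (by norm_num) (pow_le_one₀ (by norm_num) (by norm_num))
    calc ((k + 1 + 1 : ℕ) : ℝ) * ‖z‖ ^ (k + 1 + 1)
        ≤ 2 ^ (k + 1) * ((1 / 8) ^ (k + 1) * ‖z‖) := by
          rw [pow_succ ‖z‖]
          refine mul_le_mul (by linarith) ?_ (by positivity) (by positivity)
          exact mul_le_mul_of_nonneg_right hpow hzpos.le
      _ = (1 / 2) ^ (k + 1) * (1 / 2) ^ (k + 1) * ‖z‖ := by rw [← mul_assoc, h4]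
      _ ≤ (1 / 2) ^ (k + 1) * (1 / 2) * ‖z‖ := by gcongr
      _ = ‖z‖ * (1 / 2) ^ (k + 1) / 2 := by ring
  have heq : z = -∑' k : ℕ,
      (-1 : Cp) ^ (k + 1 + 1 + 1) * z ^ (k + 1 + 1) / (((k + 1 : ℕ) : Cp) + 1) := by
    simp only [zero_add, CharP.cast_eq_zero, pow_one, div_one] at hsplit
    rw [eq_neg_iff_add_eq_zero, hsplit]
    simp
  have : ‖z‖ ≤ ‖z‖ / 2 := by
    conv_lhs => rw [heq]
    rwa [norm_neg]
  linarith

theorem plog_eq_zero_iff [CompleteSpace Cp]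
    (hpadic : ∀ x : ℚ_[p], ‖algebraMap ℚ_[p] Cp x‖ = ‖x‖)
    {x : Cp} (hx : ‖x - 1‖ < 1) : plog Cp x = 0 ↔ ∃ n : ℕ, 0 < n ∧ x ^ n = 1 := by
  constructor
  · intro h0
    have hev := (tendsto_pow_prime_pow_sub_one hpadic hx).norm.eventually_le_const
      (u := 1 / 8) (by norm_num)
    obtain ⟨n, hn⟩ := hev.exists
    refine ⟨p ^ n, pow_pos (Fact.out : p.Prime).pos n,
      eq_one_of_plog_eq_zero_of_norm_le hpadic hn ?_⟩
    rw [plog_pow hpadic hx, h0, mul_zero]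
  · rintro ⟨n, hn, h⟩
    have h1 := plog_pow hpadic hx n
    rw [h, plog_one] at h1
    exact (mul_eq_zero.mp h1.symm).resolve_left (Nat.cast_ne_zero.mpr hn.ne')

end PadicLogarithm

section GroupDeterminant

variable {Q : Type*} [Group Q] [Fintype Q] [DecidableEq Q] {K : Type*} [Field K] [CharZero K]

/-- The variables `X_q` for `q ≠ 1`, extended by `X_1 = -∑ X_q` so that their sum vanishes. -/
noncomputable def sumZeroVariable (Q : Type*) [Group Q] [Fintype Q] [DecidableEq Q] (q : Q) :
    MvPolynomial {q : Q // q ≠ 1} ℚ :=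
  if h : q ≠ 1 then MvPolynomial.X ⟨q, h⟩ else -∑ i, MvPolynomial.X i

theorem det_sumZeroVariable_ne_zero :
    (Matrix.of fun h g : {q : Q // q ≠ 1} =>
      sumZeroVariable Q ((h : Q) * (g : Q)⁻¹)).det ≠ 0 := by
  intro h0
  have h1 := congrArg (MvPolynomial.eval fun _ => (-1 : ℚ)) h0
  rw [RingHom.map_det, map_zero] at h1
  obtain ⟨v, hv, hv0⟩ := Matrix.exists_mulVec_eq_zero_iff.mpr h1
  apply hv
  have hentry (h g : {q : Q // q ≠ 1}) :
      (MvPolynomial.eval fun _ => (-1 : ℚ)) (sumZeroVariable Q ((h : Q) * (g : Q)⁻¹)) =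
        (if h = g then (Fintype.card Q : ℚ) else 0) - 1 := by
    by_cases hg : h = g
    · subst hg
      have hc : Fintype.card {q : Q // q ≠ 1} = Fintype.card Q - 1 := by
        simp [Fintype.card_subtype_compl]
      have : 1 ≤ Fintype.card Q := Fintype.card_pos
      simp [sumZeroVariable, hc, Nat.cast_sub this]
    · have : (h : Q) * (g : Q)⁻¹ ≠ 1 := fun h => hg (Subtype.ext (mul_inv_eq_one.mp h))
      simp [sumZeroVariable, hg, this]
  have hrow (h : {q : Q // q ≠ 1}) : (Fintype.card Q : ℚ) * v h = ∑ g, v g := by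
    have h2 := congrFun hv0 h
    simp only [Matrix.mulVec, dotProduct, RingHom.mapMatrix_apply, Matrix.map_apply,
      Matrix.of_apply, hentry, sub_mul, one_mul, ite_mul, zero_mul, Finset.sum_sub_distrib,
      Finset.sum_ite_eq, Finset.mem_univ, if_true, Pi.zero_apply] at h2
    linarith
  have hsum : ∑ g, v g = 0 := by
    have h3 : (Fintype.card Q : ℚ) * ∑ g, v g =
        (Fintype.card {q : Q // q ≠ 1} : ℚ) * ∑ g, v g := by
      rw [Finset.mul_sum, Finset.sum_congr rfl fun h _ => hrow h]
      simp
    have hc : Fintype.card {q : Q // q ≠ 1} + 1 = Fintype.card Q := by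
      have : 1 ≤ Fintype.card Q := Fintype.card_pos
      simp [Fintype.card_subtype_compl]
      omega
    rw [← hc] at h3
    push_cast at h3
    linarith
  funext h
  have := hrow h
  rw [hsum] at this
  exact (mul_eq_zero.mp this).resolve_left (Nat.cast_ne_zero.mpr Fintype.card_ne_zero)

theorem eq_zero_of_sum_mul_eq_zero {y : Q → K} (hsum : ∑ q, y q = 0)
    (hy : AlgebraicIndependent ℚ fun q : {q : Q // q ≠ 1} => y q) {a : Q → K}
    (ha : ∀ g, ∑ h, a h * y (h * g) = 0) (h₀ : Q) (ha0 : a h₀ = 0) : a = 0 := by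
  have hval (q : Q) : MvPolynomial.aeval (fun q : {q : Q // q ≠ 1} => y q) (sumZeroVariable Q q) =
      y q := by
    by_cases hq : q = 1
    · subst hq
      have := Fintype.sum_eq_add_sum_subtype_ne y 1
      rw [hsum, eq_comm] at this
      simp [sumZeroVariable, eq_neg_of_add_eq_zero_left this]
    · simp [sumZeroVariable, hq]
  have hdet : (Matrix.of fun h g : {q : Q // q ≠ 1} => y ((h : Q) * (g : Q)⁻¹)).det ≠ 0 := by
    intro h0
    apply det_sumZeroVariable_ne_zero (Q := Q)
    apply algebraicIndependent_iff_injective_aeval.mp hy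
    rw [map_zero, AlgHom.map_det, ← h0]
    congr 1
    ext h g
    exact hval _
  have hb : (fun k : {q : Q // q ≠ 1} => a (k * h₀)) = 0 := by
    refine Matrix.eq_zero_of_vecMul_eq_zero hdet ?_
    funext g
    have h1 := ha (h₀⁻¹ * (g : Q)⁻¹)
    rw [← Equiv.sum_comp (Equiv.mulRight h₀), Fintype.sum_eq_add_sum_subtype_ne _ 1] at h1
    simpa [ha0, Matrix.vecMul, dotProduct, mul_assoc] using h1
  funext h
  by_cases hh : h = h₀
  · exact hh ▸ ha0
  · simpa using congrFun hb ⟨h * h₀⁻¹, fun h1 => hh (mul_inv_eq_one.mp h1)⟩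

end GroupDeterminant

/-- If a constant relation is, up to scaling, the only one among the vectors `R q`, then any
proper subset of them is linearly independent. -/
theorem finrank_span_image_of_sum_eq_zero {Q K V : Type*} [Fintype Q] [Nonempty Q] [Field K]
    [AddCommGroup V] [Module K V] {R : Q → V} (hsum : ∑ q, R q = 0)
    (hrel : ∀ a : Q → K, ∑ q, a q • R q = 0 → ∀ q₀, a q₀ = 0 → a = 0) (T : Set Q) :
    (Module.finrank K (Submodule.span K (R '' T)) : ℤ) =
      (Fintype.card Q : ℤ) - 1 - max ((Tᶜ.ncard : ℤ) - 1) 0 := by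
  classical
  have hcard := Set.ncard_add_ncard_compl T
  rw [Nat.card_eq_fintype_card] at hcard
  have hproper (T : Set Q) (q₀ : Q) (hq₀ : q₀ ∉ T) :
      Module.finrank K (Submodule.span K (R '' T)) = T.ncard := by
    have hli : LinearIndependent K fun q : T => R q := by
      rw [Fintype.linearIndependent_iff]
      intro g hg q
      have h := hrel (fun q => if h : q ∈ T then g ⟨q, h⟩ else 0) ?_ q₀ (by simp [hq₀])
      · simpa using congrFun h q
      · rw [← hg, ← Fintype.sum_subtype_add_sum_subtype (· ∈ T)]
        have h0 (q : {q // q ∉ T}) : (q : Q) ∉ T := q.2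
        simp [h0]
    have h := finrank_span_eq_card hli
    rw [Set.image_eq_range, h, ← Nat.card_eq_fintype_card, Nat.card_coe_set_eq]
  by_cases hT : ∃ q₀, q₀ ∉ T
  · obtain ⟨q₀, hq₀⟩ := hT
    have hpos : 0 < Tᶜ.ncard := (Set.ncard_pos (Set.toFinite _)).mpr ⟨q₀, hq₀⟩
    rw [hproper T q₀ hq₀, max_eq_left (by omega)]
    omega
  · push Not at hT
    obtain rfl : T = Set.univ := Set.eq_univ_of_forall hT
    obtain ⟨q₀⟩ := ‹Nonempty Q›
    have hspan : Submodule.span K (R '' Set.univ) = Submodule.span K (R '' {q₀}ᶜ) := by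
      refine le_antisymm (Submodule.span_le.mpr ?_)
        (Submodule.span_mono (Set.image_mono (Set.subset_univ _)))
      rintro _ ⟨q, -, rfl⟩
      by_cases hq : q = q₀
      · subst hq
        rw [← Finset.add_sum_erase _ _ (Finset.mem_univ q)] at hsum
        rw [eq_neg_of_add_eq_zero_left hsum]
        refine Submodule.neg_mem _ (Submodule.sum_mem _ fun i hi => Submodule.subset_span ?_)
        exact ⟨i, by simpa using hi, rfl⟩
      · exact Submodule.subset_span ⟨q, hq, rfl⟩
    have h1 := Set.ncard_add_ncard_compl {q₀}
    rw [Nat.card_eq_fintype_card, Set.ncard_singleton] at h1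
    rw [hspan, hproper _ q₀ (by simp)]
    simp
    omega

theorem linearIndependent_int_of_sum_eq_zero {Q W : Type*} [Fintype Q] [AddCommGroup W]
    [Module.Free ℤ W] [Module.Finite ℤ W] {v : Q → W} (hsum : ∑ q, v q = 0)
    (hcard : Module.finrank ℤ W + 1 = Fintype.card Q)
    (hspan : ∀ w : W, ∃ n : ℤ, n ≠ 0 ∧ n • w ∈ Submodule.span ℤ (Set.range v))
    (q₀ : Q) {a : Q → ℤ} (ha : ∑ q, a q • v q = 0) (ha0 : a q₀ = 0) : a = 0 := by
  let F : (Q → ℤ) →ₗ[ℤ] W × ℤ := (Fintype.linearCombination ℤ v).prod (LinearMap.proj q₀)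
  have hF (b : Q → ℤ) : F b = (∑ q, b q • v q, b q₀) := rfl
  have htors : Module.IsTorsion ℤ ((W × ℤ) ⧸ LinearMap.range F) := by
    intro x
    obtain ⟨⟨w, m⟩, rfl⟩ := Submodule.Quotient.mk_surjective _ x
    obtain ⟨n, hn, hw⟩ := hspan w
    refine ⟨⟨n, mem_nonZeroDivisors_of_ne_zero hn⟩, ?_⟩
    change n • (Submodule.Quotient.mk (p := LinearMap.range F) (w, m)) = 0
    rw [← Submodule.Quotient.mk_smul (LinearMap.range F), Submodule.Quotient.mk_eq_zero]
    obtain ⟨b, hb⟩ := (Submodule.mem_span_range_iff_exists_fun ℤ).mp hw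
    refine ⟨fun q => b q + (n * m - b q₀), ?_⟩
    rw [hF]
    simp [add_smul, Finset.sum_add_distrib, hb, ← Finset.smul_sum, hsum]
  have hker : Module.finrank ℤ (LinearMap.ker F) = 0 := by
    have h1 := Module.finrank_eq_zero_iff_isTorsion.mpr htors
    have h2 := Submodule.finrank_quotient_add_finrank (R := ℤ) (LinearMap.range F)
    have h3 := Submodule.finrank_quotient_add_finrank (R := ℤ) (LinearMap.ker F)
    rw [F.quotKerEquivRange.finrank_eq] at h3
    rw [Module.finrank_prod, Module.finrank_self] at h2
    rw [Module.finrank_fintype_fun_eq_card] at h3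
    omega
  have hbot : LinearMap.ker F = ⊥ := Submodule.finrank_eq_zero.mp hker
  have hmem : a ∈ LinearMap.ker F := by
    rw [LinearMap.mem_ker, hF, ha, ha0]
    rfl
  rwa [hbot, Submodule.mem_bot] at hmem

section ComplexConjugation

variable {M : Type*} [Field M] [NumberField M] [IsGalois ℚ M]

theorem exists_algEquiv_comp_eq {L : Type*} [Field L] [CharZero L] (σ τ : M →+* L) :
    ∃ g : M ≃ₐ[ℚ] M, τ = σ.comp (g : M →+* M) := by
  let : Algebra M L := σ.toAlgebra
  refine ⟨Normal.algHomEquivAut ℚ L M τ.toRatAlgHom, ?_⟩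
  have h := (Normal.algHomEquivAut ℚ L M).symm_apply_apply τ.toRatAlgHom
  exact RingHom.ext fun x => (DFunLike.congr_fun h x).symm

variable {c : M ≃ₐ[ℚ] M}

theorem apply_conj_eq_star (hC : {g : M ≃ₐ[ℚ] M | InducedByConj M g} = {c})
    (τ : M →+* ℂ) (x : M) : τ (c x) = (starRingEnd ℂ) (τ x) := by
  have hc : InducedByConj M c := by
    change c ∈ {g : M ≃ₐ[ℚ] M | InducedByConj M g}
    rw [hC]
    rfl
  obtain ⟨τ₀, h₀⟩ := hc
  obtain ⟨g, rfl⟩ := exists_algEquiv_comp_eq τ₀ τ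
  have hg : g⁻¹ * c * g ∈ {g : M ≃ₐ[ℚ] M | InducedByConj M g} := by
    refine ⟨τ₀.comp (g : M →+* M), fun y => ?_⟩
    have : g (g⁻¹ (c (g y))) = c (g y) := g.apply_symm_apply _
    simp [AlgEquiv.mul_apply, h₀]
  rw [hC] at hg
  have hcomm : c * g = g * c := by
    have h : g * (g⁻¹ * c * g) = c * g := by group
    rw [Set.mem_singleton_iff.mp hg] at h
    exact h.symm
  have : g (c x) = c (g x) := (AlgEquiv.congr_fun hcomm x).symm
  simp [this, h₀]

theorem conj_mul_comm (hC : {g : M ≃ₐ[ℚ] M | InducedByConj M g} = {c})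
    (g : M ≃ₐ[ℚ] M) : c * g = g * c := by
  obtain ⟨τ⟩ : Nonempty (M →+* ℂ) := inferInstance
  ext x
  apply τ.injective
  have h1 := apply_conj_eq_star hC τ (g x)
  have h2 := apply_conj_eq_star hC (τ.comp (g : M →+* M)) x
  exact h1.trans h2.symm

theorem conj_mul_self (hC : {g : M ≃ₐ[ℚ] M | InducedByConj M g} = {c}) : c * c = 1 := by
  obtain ⟨τ⟩ : Nonempty (M →+* ℂ) := inferInstance
  ext x
  apply τ.injective
  simp [AlgEquiv.mul_apply, apply_conj_eq_star hC]

theorem conj_ne_one (hC : {g : M ≃ₐ[ℚ] M | InducedByConj M g} = {c}) (hCM : IsCMExt M) :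
    c ≠ 1 := by
  rintro rfl
  obtain ⟨τ⟩ : Nonempty (M →+* ℂ) := inferInstance
  obtain ⟨x, hx⟩ := hCM.1 τ
  exact hx (Complex.conj_eq_iff_im.mp (apply_conj_eq_star hC τ x).symm)

omit [IsGalois ℚ M] in
theorem IsCMExt.isTotallyComplex (hCM : IsCMExt M) : NumberField.IsTotallyComplex M := by
  refine ⟨fun w => ?_⟩
  rw [NumberField.InfinitePlace.isComplex_iff]
  intro hreal
  obtain ⟨x, hx⟩ := hCM.1 w.embedding
  exact hx (Complex.conj_eq_iff_im.mp (RingHom.congr_fun hreal x))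

theorem two_mul_rank_add_one (hCM : IsCMExt M) :
    2 * (NumberField.Units.rank M + 1) = Nat.card (M ≃ₐ[ℚ] M) := by
  have := hCM.isTotallyComplex
  rw [IsGalois.card_aut_eq_finrank, NumberField.IsTotallyComplex.finrank, NumberField.Units.rank,
    Nat.sub_add_cancel Fintype.card_pos,
    NumberField.InfinitePlace.card_eq_nrRealPlaces_add_nrComplexPlaces,
    NumberField.IsTotallyComplex.nrRealPlaces_eq_zero, zero_add]

theorem place_conj (hC : {g : M ≃ₐ[ℚ] M | InducedByConj M g} = {c})
    (w : NumberField.InfinitePlace M) (x : M) : w (c x) = w x := by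
  rw [← NumberField.InfinitePlace.norm_embedding_eq, ← NumberField.InfinitePlace.norm_embedding_eq,
    apply_conj_eq_star hC]
  exact RCLike.norm_conj _

end ComplexConjugation

theorem sum_comp_eq_two_nsmul {G Q B : Type*} [Group G] [Fintype G] [Fintype Q] [AddCommMonoid B]
    {c : G} (hc : c ≠ 1) {π : G → Q} (hsurj : Function.Surjective π)
    (hπ : ∀ g h, π g = π h ↔ h = g ∨ h = c * g) (f : Q → B) :
    ∑ g, f (π g) = 2 • ∑ q, f q := by
  classical
  rw [Finset.sum_comp, Finset.image_univ_of_surjective hsurj, Finset.smul_sum]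
  refine Finset.sum_congr rfl fun q _ => ?_
  obtain ⟨g, rfl⟩ := hsurj q
  congr 1
  have : ({a | π a = π g} : Finset G) = {g, c * g} := by
    ext h
    rw [Finset.mem_filter_univ, eq_comm, hπ, Finset.mem_insert, Finset.mem_singleton]
  rw [this, Finset.card_pair]
  simpa [eq_comm] using hc

theorem tcos_eq_ncard {M : Type*} [Field M] [NumberField M] {c : M ≃ₐ[ℚ] M} {Q : Type*}
    {π : (M ≃ₐ[ℚ] M) → Q} (hsurj : Function.Surjective π)
    (hπ : ∀ g h, π g = π h ↔ h = g ∨ h = c * g) (J : Set (M ≃ₐ[ℚ] M)) :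
    tcos c J = (π '' Jᶜ)ᶜ.ncard := by
  have hfiber (g) : π ⁻¹' {π g} = {g, c * g} := by
    ext h
    rw [Set.mem_preimage, Set.mem_singleton_iff, eq_comm, hπ]
    rfl
  have hset : {s : Set (M ≃ₐ[ℚ] M) | (∃ g, s = {g, c * g}) ∧ s ⊆ J} =
      (fun q => π ⁻¹' {q}) '' (π '' Jᶜ)ᶜ := by
    ext s
    constructor
    · rintro ⟨⟨g, rfl⟩, hs⟩
      refine ⟨π g, ?_, hfiber g⟩
      rintro ⟨h, hh, hhg⟩
      have : h ∈ π ⁻¹' {π g} := hhg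
      rw [hfiber] at this
      exact hh (hs this)
    · rintro ⟨q, hq, rfl⟩
      obtain ⟨g, rfl⟩ := hsurj q
      refine ⟨⟨g, hfiber g⟩, fun h hh => ?_⟩
      by_contra hJ
      exact hq ⟨h, hJ, hh⟩
  rw [tcos, hset]
  refine Set.ncard_image_of_injective _ fun q q' h => ?_
  obtain ⟨g, rfl⟩ := hsurj q
  have : g ∈ π ⁻¹' {q'} := by
    rw [← show (fun q => π ⁻¹' {q}) (π g) = π ⁻¹' {q'} from h]
    rfl
  exact this

section UnitLogarithm

variable {p : ℕ} [Fact p.Prime] {Cp : Type*} [NormedField Cp] [Algebra ℚ_[p] Cp]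
  {M : Type*} [Field M] [NumberField M]

/-- The units that `σ` sends into the open unit disc around `1`. -/
def principalUnits (hpadic : ∀ x : ℚ_[p], ‖algebraMap ℚ_[p] Cp x‖ = ‖x‖) (σ : M →+* Cp) :
    Subgroup (𝓞 M)ˣ where
  carrier := {e | ‖σ (algebraMap (𝓞 M) M e) - 1‖ < 1}
  mul_mem' {x y} hx hy := by
    simpa using norm_mul_sub_one_lt_one hpadic hx hy
  one_mem' := by simp
  inv_mem' {x} hx := by
    have := isUltrametricDist_of_padic hpadic
    rw [Set.mem_ofPred_eq] at hx ⊢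
    set s := σ (algebraMap (𝓞 M) M x)
    set t := σ (algebraMap (𝓞 M) M (x⁻¹ : (𝓞 M)ˣ))
    have hst : s * t = 1 := by
      rw [← map_mul, ← map_mul, Units.mul_inv, map_one, map_one]
    have hs : 1 ≤ ‖s‖ := by
      by_contra! hlt
      have h := IsUltrametricDist.norm_add_le_max s (-(s - 1))
      rw [← sub_eq_add_neg, sub_sub_cancel, norm_one, norm_neg] at h
      exact absurd h (not_le.mpr (max_lt hlt hx))
    have ht : t - 1 = -t * (s - 1) := by linear_combination hst
    have htn : ‖t‖ ≤ 1 := by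
      have := congrArg norm hst
      rw [norm_mul, norm_one] at this
      nlinarith [norm_nonneg t]
    rw [ht, norm_mul, norm_neg]
    exact mul_lt_one_of_nonneg_of_lt_one_right htn (norm_nonneg _) hx

/-- The logarithmic embedding of the units with values in the unit lattice, that is, the class
of a unit modulo torsion. -/
noncomputable def unitClass (M : Type*) [Field M] [NumberField M] :
    Additive (𝓞 M)ˣ →+ NumberField.Units.unitLattice M :=
  (NumberField.Units.logEmbedding M).codRestrict (NumberField.Units.unitLattice M)
    fun _ => Submodule.mem_map_of_mem trivial

theorem unitClass_ofMul_eq_zero_iff {e : (𝓞 M)ˣ} :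
    unitClass M (Additive.ofMul e) = 0 ↔ e ∈ NumberField.Units.torsion M := by
  rw [← NumberField.Units.dirichletUnitTheorem.logEmbedding_eq_zero_iff, ← Submodule.coe_eq_zero]
  rfl

theorem unitClass_surjective : Function.Surjective (unitClass M) := by
  rintro ⟨_, e, -, rfl⟩
  exact ⟨e, rfl⟩

variable [CharZero Cp] [CompleteSpace Cp]

/-- The `p`-adic logarithm of `σ` as a homomorphism on the units principal at `σ`. -/
noncomputable def unitPlog (hpadic : ∀ x : ℚ_[p], ‖algebraMap ℚ_[p] Cp x‖ = ‖x‖) (σ : M →+* Cp) :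
    Additive (principalUnits hpadic σ) →+ Cp :=
  AddMonoidHom.mk' (fun e => plog Cp (σ (algebraMap (𝓞 M) M (e.toMul : (𝓞 M)ˣ)))) fun x y => by
    have hx : ‖σ (algebraMap (𝓞 M) M (x.toMul : (𝓞 M)ˣ)) - 1‖ < 1 := x.toMul.2
    have hy : ‖σ (algebraMap (𝓞 M) M (y.toMul : (𝓞 M)ˣ)) - 1‖ < 1 := y.toMul.2
    have h := plog_mul hpadic hx hy
    simpa using h

theorem unitPlog_eq_zero_iff (hpadic : ∀ x : ℚ_[p], ‖algebraMap ℚ_[p] Cp x‖ = ‖x‖)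
    (σ : M →+* Cp) (x : Additive (principalUnits hpadic σ)) :
    unitPlog hpadic σ x = 0 ↔
      unitClass M (MonoidHom.toAdditive (principalUnits hpadic σ).subtype x) = 0 := by
  change plog Cp (σ (algebraMap (𝓞 M) M (x.toMul : (𝓞 M)ˣ))) = 0 ↔
    unitClass M (Additive.ofMul (x.toMul : (𝓞 M)ˣ)) = 0
  have hx : ‖σ (algebraMap (𝓞 M) M (x.toMul : (𝓞 M)ˣ)) - 1‖ < 1 := x.toMul.2
  rw [plog_eq_zero_iff hpadic hx, unitClass_ofMul_eq_zero_iff, NumberField.Units.torsion,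
    CommGroup.mem_torsion, isOfFinOrder_iff_pow_eq_one]
  refine exists_congr fun n => and_congr_right fun _ => ?_
  rw [← map_pow, ← map_pow, ← Units.val_pow_eq_pow_val, map_eq_one_iff σ σ.injective,
    map_eq_one_iff _ (FaithfulSMul.algebraMap_injective (𝓞 M) M), Units.val_eq_one]

end UnitLogarithm

section ConjugateUnits

variable {M : Type*} [Field M] [NumberField M] [IsGalois ℚ M] {ε : (𝓞 M)ˣ}
  {u : (M ≃ₐ[ℚ] M) → (𝓞 M)ˣ}

theorem sum_unitClass_eq_zero
    (hu : ∀ g, algebraMap (𝓞 M) M (u g) = g (algebraMap (𝓞 M) M ε)) :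
    ∑ g, unitClass M (Additive.ofMul (u g)) = 0 := by
  rw [← map_sum, ← ofMul_prod, unitClass_ofMul_eq_zero_iff, NumberField.Units.torsion,
    CommGroup.mem_torsion, isOfFinOrder_iff_pow_eq_one]
  refine ⟨2, two_pos, NumberField.Units.coe_injective M ?_⟩
  have hprod : algebraMap (𝓞 M) M ((∏ g, u g : (𝓞 M)ˣ) : 𝓞 M) =
      algebraMap ℚ M (Algebra.norm ℚ (algebraMap (𝓞 M) M ε)) := by
    rw [Algebra.norm_eq_prod_automorphisms, Units.coe_prod, map_prod]
    exact Finset.prod_congr rfl fun g _ => hu g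
  change algebraMap (𝓞 M) M ((∏ g, u g : (𝓞 M)ˣ) ^ 2 : (𝓞 M)ˣ) =
    algebraMap (𝓞 M) M ((1 : (𝓞 M)ˣ) : 𝓞 M)
  rw [Units.val_pow_eq_pow_val, map_pow, hprod, ← map_pow, ← sq_abs,
    NumberField.Units.norm M ε]
  simp

theorem unitClass_conj_mul {c : M ≃ₐ[ℚ] M} (hC : {g : M ≃ₐ[ℚ] M | InducedByConj M g} = {c})
    (hu : ∀ g, algebraMap (𝓞 M) M (u g) = g (algebraMap (𝓞 M) M ε)) (g : M ≃ₐ[ℚ] M) :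
    unitClass M (Additive.ofMul (u (c * g))) = unitClass M (Additive.ofMul (u g)) := by
  rw [← sub_eq_zero, ← map_sub, ← ofMul_div, unitClass_ofMul_eq_zero_iff,
    NumberField.Units.mem_torsion]
  intro w
  have h : ((u (c * g) / u g : (𝓞 M)ˣ) : M) = c (u g : M) / (u g : M) := by
    rw [eq_div_iff (NumberField.Units.coe_ne_zero _), ← NumberField.Units.coe_mul, div_mul_cancel,
      hu, hu]
    rfl
  rw [h, map_div₀, place_conj hC, div_self (NumberField.Units.pos_at_place _ w).ne']

omit [IsGalois ℚ M] in
theorem exists_zsmul_mem_span_unitClass (hfin : (Subgroup.closure (Set.range u)).FiniteIndex)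
    (w : NumberField.Units.unitLattice M) :
    ∃ n : ℤ, n ≠ 0 ∧
      n • w ∈ Submodule.span ℤ (Set.range fun g => unitClass M (Additive.ofMul (u g))) := by
  obtain ⟨e, rfl⟩ := unitClass_surjective w
  obtain ⟨n, hn, -, hmem⟩ := Subgroup.exists_pow_mem_of_index_ne_zero hfin.index_ne_zero e.toMul
  refine ⟨n, by exact_mod_cast hn.ne', ?_⟩
  have key (x : (𝓞 M)ˣ) (hx : x ∈ Subgroup.closure (Set.range u)) :
      unitClass M (Additive.ofMul x) ∈
        Submodule.span ℤ (Set.range fun g => unitClass M (Additive.ofMul (u g))) := by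
    induction hx using Subgroup.closure_induction with
    | mem x hx =>
      obtain ⟨g, rfl⟩ := hx
      exact Submodule.subset_span ⟨g, rfl⟩
    | one => simp
    | mul x y _ _ hx hy => rw [ofMul_mul, map_add]; exact Submodule.add_mem _ hx hy
    | inv x _ hx => rw [ofMul_inv, map_neg]; exact Submodule.neg_mem _ hx
  have h := key _ hmem
  rwa [ofMul_pow, map_nsmul, ofMul_toMul, ← natCast_zsmul] at h

end ConjugateUnits

theorem quotient_mk_eq_iff {G : Type*} [Group G] {c : G} (hcc : c * c = 1)
    (hcomm : ∀ g, c * g = g * c) (g h : G) :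
    (g : G ⧸ Subgroup.zpowers c) = h ↔ h = g ∨ h = c * g := by
  rw [QuotientGroup.eq, Subgroup.mem_zpowers_iff]
  constructor
  · rintro ⟨n, hn⟩
    rw [eq_inv_mul_iff_mul_eq] at hn
    obtain ⟨k, rfl⟩ | ⟨k, rfl⟩ := n.even_or_odd
    · left
      rw [← hn, zpow_add, ← (Commute.refl c).mul_zpow, hcc]
      simp
    · right
      rw [← hn, zpow_add, zpow_mul, zpow_ofNat, pow_two, hcc, hcomm]
      simp
  · rintro (rfl | rfl)
    · exact ⟨0, by simp⟩
    · exact ⟨1, by rw [hcomm]; simp⟩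

theorem PadicSchanuel.algebraicIndependent {Cp : Type*} [NormedField Cp] [CharZero Cp]
    (hSch : PadicSchanuel Cp) {ι : Type*} [Fintype ι] {α : ι → Cp}
    (halg : ∀ i, IsAlgebraic ℚ (α i)) (hα : ∀ i, ‖α i - 1‖ < 1)
    (hind : ∀ a : ι → ℤ, ∑ i, a i • plog Cp (α i) = 0 → a = 0) :
    AlgebraicIndependent ℚ fun i => plog Cp (α i) := by
  let e := Fintype.equivFin ι
  have hlin : LinearIndependent ℚ fun i => plog Cp (α i) := by
    rw [← LinearIndependent.iff_fractionRing ℤ ℚ, Fintype.linearIndependent_iff]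
    exact fun a ha i => congrFun (hind a ha) i
  rw [← algebraicIndependent_equiv e.symm]
  exact hSch _ (α ∘ e.symm) (fun i => halg _) (fun i => hα _) (hlin.comp _ e.symm.injective)

section Rank

variable {Cp : Type*} [NormedField Cp] [CharZero Cp]
  {M : Type*} [Field M] [NumberField M] [IsGalois ℚ M] {c : M ≃ₐ[ℚ] M}
  {Q : Type*} [Group Q] [Fintype Q] {π : (M ≃ₐ[ℚ] M) →* Q}

theorem rank_padicLogMatrix_eq (hsurj : Function.Surjective π)
    (hπ : ∀ g h, π g = π h ↔ h = g ∨ h = c * g) {σ : M →+* Cp} {ε : M} {y : Q → Cp}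
    (hy : ∀ g, plog Cp (σ (g ε)) = y (π g)) (hsum : ∑ q, y q = 0)
    (hind : AlgebraicIndependent ℚ fun q : {q : Q // q ≠ 1} => y q) (Sp : Set (M →+* Cp)) :
    ((padicLogMatrix Cp M Sp ε).rank : ℤ) =
      (Fintype.card Q : ℤ) - 1 - max ((tcos c (Jset Cp M Sp σ) : ℤ) - 1) 0 := by
  classical
  let R : Q → (M ≃ₐ[ℚ] M) → Cp := fun q g => y (q * π g)
  have hrow (h : M ≃ₐ[ℚ] M) (hh : σ.comp (h : M →+* M) ∈ Sp) :
      (padicLogMatrix Cp M Sp ε).row ⟨_, hh⟩ = R (π h) := by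
    ext g
    change plog Cp (σ ((h * g) ε)) = y (π h * π g)
    rw [hy, map_mul]
  have hrange : Set.range (padicLogMatrix Cp M Sp ε).row = R '' (π '' (Jset Cp M Sp σ)ᶜ) := by
    ext r
    constructor
    · rintro ⟨⟨τ, hτ⟩, rfl⟩
      obtain ⟨h, rfl⟩ := exists_algEquiv_comp_eq σ τ
      exact ⟨π h, ⟨h, not_not.mpr hτ, rfl⟩, (hrow h hτ).symm⟩
    · rintro ⟨_, ⟨h, hh, rfl⟩, rfl⟩
      exact ⟨⟨_, not_not.mp hh⟩, hrow h (not_not.mp hh)⟩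
  have hRsum : ∑ q, R q = 0 := by
    ext g
    rw [Finset.sum_apply, Pi.zero_apply, ← hsum]
    exact Equiv.sum_comp (Equiv.mulRight (π g)) y
  have hrel (a : Q → Cp) (ha : ∑ q, a q • R q = 0) (q₀ : Q) (ha0 : a q₀ = 0) : a = 0 := by
    refine eq_zero_of_sum_mul_eq_zero hsum hind (fun q => ?_) q₀ ha0
    obtain ⟨g, rfl⟩ := hsurj q
    simpa [R] using congrFun ha g
  have : Finite Sp := inferInstance
  rw [Matrix.rank_eq_finrank_span_row, hrange, tcos_eq_ncard hsurj hπ]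
  exact finrank_span_image_of_sum_eq_zero hRsum hrel _

variable [CompleteSpace Cp] {p : ℕ} [Fact p.Prime] [Algebra ℚ_[p] Cp]

theorem exists_plog_eq_comp (hpadic : ∀ x : ℚ_[p], ‖algebraMap ℚ_[p] Cp x‖ = ‖x‖)
    (hC : {g : M ≃ₐ[ℚ] M | InducedByConj M g} = {c}) (hc : c ≠ 1)
    (hsurj : Function.Surjective π) (hπ : ∀ g h, π g = π h ↔ h = g ∨ h = c * g)
    (hcard : NumberField.Units.rank M + 1 = Fintype.card Q)
    {ε : (𝓞 M)ˣ} (hWM : IsWeakMinkowskiUnit M ε) {σ : M →+* Cp}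
    (hloc : ∀ g : M ≃ₐ[ℚ] M, ‖σ (g (algebraMap (𝓞 M) M ε)) - 1‖ < 1)
    (hSch : PadicSchanuel Cp) :
    ∃ y : Q → Cp, (∀ g, plog Cp (σ (g (algebraMap (𝓞 M) M ε))) = y (π g)) ∧ ∑ q, y q = 0 ∧
      AlgebraicIndependent ℚ fun q : {q : Q // q ≠ 1} => y q := by
  classical
  obtain ⟨u, hu, hfin⟩ := hWM
  obtain ⟨s, hs⟩ := hsurj.hasRightInverse
  let x (g : M ≃ₐ[ℚ] M) : Additive (principalUnits hpadic σ) :=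
    Additive.ofMul ⟨u g, by
      change ‖σ (algebraMap (𝓞 M) M (u g)) - 1‖ < 1
      rw [hu]
      exact hloc g⟩
  let κ : Additive (principalUnits hpadic σ) →+ NumberField.Units.unitLattice M :=
    (unitClass M).comp (MonoidHom.toAdditive (principalUnits hpadic σ).subtype)
  let ℓ : Additive (principalUnits hpadic σ) →+ Cp := unitPlog hpadic σ
  have hκℓ (z) : ℓ z = 0 ↔ κ z = 0 := unitPlog_eq_zero_iff hpadic σ z
  have hℓ (g) : ℓ (x g) = plog Cp (σ (g (algebraMap (𝓞 M) M ε))) := by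
    rw [← hu]
    rfl
  have hκ (g) : κ (x (s (π g))) = κ (x g) := by
    rcases (hπ g _).mp (hs (π g)).symm with h | h
    · rw [h]
    · rw [h]
      exact unitClass_conj_mul hC hu g
  have hsumκ : ∑ q, κ (x (s q)) = 0 := by
    have h2 : 2 • ∑ q, κ (x (s q)) = 0 := by
      rw [← sum_comp_eq_two_nsmul hc hsurj hπ fun q => κ (x (s q))]
      simp_rw [hκ]
      exact sum_unitClass_eq_zero hu
    exact (smul_eq_zero_iff_right two_ne_zero).mp h2
  have hrange : Set.range (fun q => κ (x (s q))) =
      Set.range fun g => unitClass M (Additive.ofMul (u g)) := by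
    rw [← hsurj.range_comp]
    exact congrArg Set.range (funext hκ)
  have hfree : Module.Free ℤ (NumberField.Units.unitLattice M) :=
    Module.Free.of_basis (NumberField.Units.basisUnitLattice M)
  have hfinite : Module.Finite ℤ (NumberField.Units.unitLattice M) :=
    Module.Finite.of_basis (NumberField.Units.basisUnitLattice M)
  have hind (a : Q → ℤ) (ha : ∑ q, a q • ℓ (x (s q)) = 0) (ha1 : a 1 = 0) : a = 0 := by
    refine linearIndependent_int_of_sum_eq_zero (v := fun q => κ (x (s q))) hsumκ
      (by rw [NumberField.Units.unitLattice_rank, hcard])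
      (fun w => ?_) 1 ?_ ha1
    · rw [hrange]
      exact exists_zsmul_mem_span_unitClass hfin w
    · simp_rw [← map_zsmul, ← map_sum] at ha ⊢
      exact (hκℓ _).mp ha
  refine ⟨fun q => ℓ (x (s q)), fun g => ?_, ?_, ?_⟩
  · rw [← hℓ, ← sub_eq_zero, ← map_sub, hκℓ, map_sub, hκ, sub_self]
  · rw [← map_sum, hκℓ, map_sum]
    exact hsumκ
  · simp_rw [hℓ]
    refine hSch.algebraicIndependent (fun q => ?_) (fun q => hloc _) fun a ha => ?_
    · exact (Algebra.IsAlgebraic.isAlgebraic (R := ℚ) _).algHom (σ.toRatAlgHom)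
    · let b : Q → ℤ := fun q => if h : q ≠ 1 then a ⟨q, h⟩ else 0
      have hb : b = 0 := by
        refine hind b ?_ (by simp [b])
        rw [Fintype.sum_eq_add_sum_subtype_ne _ 1, ← ha]
        simp only [b, ne_eq, not_true_eq_false, dite_false, zero_smul, zero_add, hℓ]
        exact Finset.sum_congr rfl fun q _ => by rw [dif_pos q.2]
      ext q
      have := congrFun hb q.1
      simpa [b, q.2] using this

end Rank

/-- Suppose `M` is CM over `ℚ`, with `c` the unique element of `G` induced
by complex conjugation and `t = t_c`. Assuming Schanuel's conjecture and its `p`-adic version,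
the rank of the `p`-adic log matrix over `S_p × G` equals `r − (t−1)⁺`
(for any choice of `σ ∈ E_p` used to define `J_σ`). -/
theorem stmt3 (p : ℕ) [Fact p.Prime]
    (Cp : Type*) [NormedField Cp] [CompleteSpace Cp] [IsAlgClosed Cp] [CharZero Cp]
    [Algebra ℚ_[p] Cp] (hpadic : ∀ x : ℚ_[p], ‖algebraMap ℚ_[p] Cp x‖ = ‖x‖)
    (hiso : Nonempty (Cp ≃+* ℂ))
    (M : Type*) [Field M] [NumberField M] [IsGalois ℚ M]
    (hCM : IsCMExt M)
    (c : M ≃ₐ[ℚ] M) (hC : {g : M ≃ₐ[ℚ] M | InducedByConj M g} = {c})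
    (Sp : Set (M →+* Cp))
    (ε : (𝓞 M)ˣ) (hWM : IsWeakMinkowskiUnit M ε)
    (hloc : ∀ (σ : M →+* Cp) (g : M ≃ₐ[ℚ] M), ‖σ (g (algebraMap (𝓞 M) M ε)) - 1‖ < 1)
    (hSch : PadicSchanuel Cp) (hSchR : RealSchanuel) :
    ∀ σ : M →+* Cp,
      ((padicLogMatrix Cp M Sp (algebraMap (𝓞 M) M ε)).rank : ℤ) =
        (NumberField.Units.rank M : ℤ) -
          max ((tcos c (Jset Cp M Sp σ) : ℤ) - 1) 0 := by
  intro σ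
  have hcomm := conj_mul_comm hC
  have hc := conj_ne_one hC hCM
  have : (Subgroup.zpowers c).Normal := by
    refine ⟨fun x hx g => ?_⟩
    obtain ⟨n, rfl⟩ := Subgroup.mem_zpowers_iff.mp hx
    have h : Commute g c := (hcomm g).symm
    rwa [(h.zpow_right n).eq, mul_inv_cancel_right]
  let π := QuotientGroup.mk' (Subgroup.zpowers c)
  have := Fintype.ofFinite ((M ≃ₐ[ℚ] M) ⧸ Subgroup.zpowers c)
  have hsurj : Function.Surjective π := QuotientGroup.mk'_surjective _
  have hπ : ∀ g h, π g = π h ↔ h = g ∨ h = c * g :=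
    quotient_mk_eq_iff (conj_mul_self hC) hcomm
  have hcard : NumberField.Units.rank M + 1 =
      Fintype.card ((M ≃ₐ[ℚ] M) ⧸ Subgroup.zpowers c) := by
    have h1 := two_mul_rank_add_one hCM
    have h2 := sum_comp_eq_two_nsmul hc hsurj hπ fun _ => 1
    simp only [Finset.sum_const, Finset.card_univ, smul_eq_mul, mul_one] at h2
    rw [Nat.card_eq_fintype_card] at h1
    omega
  obtain ⟨y, hy, hsum, hind⟩ :=
    exists_plog_eq_comp hpadic hC hc hsurj hπ hcard hWM (hloc σ) hSch
  rw [rank_padicLogMatrix_eq hsurj hπ hy hsum hind, ← hcard, Nat.cast_add, Nat.cast_one,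
    add_sub_cancel_right]
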